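/- Let b > 1, c > 1, d + e − b − c > 0, min(b, c) < min(d, e), and x > 0. Then 1/(1 + x·bc/(de)) < G(1, b, c; d, e; −x) < 1/(1 + x·(b−1)(c−1)/((d−1)(e−1))). -/

import Mathlib

open MeasureTheory Real

/-- Pochhammer symbol `(a)_n = a(a+1)⋯(a+n−1)`. -/
noncomputable def poch (a : ℝ) (n : ℕ) : ℝ := (ascPochhammer ℝ n).eval a

/-- Gauss hypergeometric series `₂F₁(α, β; γ; y)`. -/
noncomputable def F21 (α β γ y : ℝ) : ℝ :=
  ∑' n : ℕ, poch α n * poch β n / (poch γ n * (n.factorial : ℝ)) * y ^ n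

/-- `G(a, b, c; d, e; −x) = ₃F₂(a, b, c; d, e; −x)` defined via the integral
representation of Lemma 2. -/
noncomputable def G32 (a b c d e x : ℝ) : ℝ :=
  Gamma d * Gamma e / (Gamma b * Gamma c * Gamma (d + e - b - c)) *
    ∫ t in Set.Ioo (0 : ℝ) 1,
      t ^ (b - 1) * (1 - t) ^ (d + e - b - c - 1) * (1 + x * t) ^ (-a) *
        F21 (e - c) (d - c) (d + e - b - c) (1 - t)

open Filter Topology Asymptotics

lemma poch_zero (a : ℝ) : poch a 0 = 1 := by simp [poch]

lemma poch_succ (a : ℝ) (n : ℕ) : poch a (n + 1) = poch a n * (a + n) := by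
  simp [poch, ascPochhammer_succ_eval]

lemma poch_pos {a : ℝ} (ha : 0 < a) (n : ℕ) : 0 < poch a n := ascPochhammer_pos n a ha

lemma poch_eq_prod (a : ℝ) (n : ℕ) : poch a n = ∏ j ∈ Finset.range n, (a + j) := by
  induction n with
  | zero => simp [poch_zero]
  | succ n ih => rw [poch_succ, ih, Finset.prod_range_succ]

lemma gammaSeq_eq (a : ℝ) (n : ℕ) :
    GammaSeq a n = (n : ℝ) ^ a * n.factorial / poch a (n + 1) := by
  rw [GammaSeq, poch_eq_prod]

lemma poch_shift (a : ℝ) (n : ℕ) : a * poch (a + 1) n = poch a n * (a + n) := by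
  rw [← poch_succ, poch_eq_prod, poch_eq_prod, Finset.prod_range_succ']
  simp only [Nat.cast_add, Nat.cast_one, Nat.cast_zero, add_zero]
  rw [mul_comm]
  congr 1
  apply Finset.prod_congr rfl
  intros; ring

lemma poch_bigO (a : ℝ) :
    (fun n : ℕ => poch a (n + 1)) =O[atTop] (fun n : ℕ => (n : ℝ) ^ a * n.factorial) := by
  by_cases h : ∃ m : ℕ, a = -m
  · obtain ⟨m, rfl⟩ := h
    have : (fun n : ℕ => poch (-(m : ℝ)) (n + 1)) =ᶠ[atTop] fun _ => (0 : ℝ) := by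
      filter_upwards [eventually_ge_atTop m] with n hn
      rw [poch_eq_prod]
      exact Finset.prod_eq_zero (i := m) (by simp; omega) (by simp)
    exact this.trans_isBigO (isBigO_zero _ _)
  · push Not at h
    have hG : Gamma a ≠ 0 := Gamma_ne_zero h
    have ht := (GammaSeq_tendsto_Gamma a).inv₀ hG
    have h1 := ht.isBigO_one ℝ
    have h2 := h1.mul (isBigO_refl (fun n : ℕ => (n : ℝ) ^ a * n.factorial) atTop)
    refine (EventuallyEq.isBigO ?_).trans (h2.trans (EventuallyEq.isBigO ?_))
    · filter_upwards [eventually_gt_atTop 0] with n hn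
      have : (0 : ℝ) < (n : ℝ) ^ a * n.factorial := by positivity
      rw [gammaSeq_eq, inv_div, div_mul_cancel₀ _ this.ne']
    · filter_upwards with n
      simp

lemma poch_inv_bigO {g : ℝ} (hg : 0 < g) :
    (fun n : ℕ => (poch g (n + 1))⁻¹) =O[atTop]
      (fun n : ℕ => ((n : ℝ) ^ g * n.factorial)⁻¹) := by
  have h1 := (GammaSeq_tendsto_Gamma g).isBigO_one ℝ
  have h2 := h1.mul (isBigO_refl (fun n : ℕ => ((n : ℝ) ^ g * n.factorial)⁻¹) atTop)
  refine (EventuallyEq.isBigO ?_).trans (h2.trans (EventuallyEq.isBigO ?_))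
  · filter_upwards [eventually_gt_atTop 0] with n hn
    have : (0 : ℝ) < (n : ℝ) ^ g * n.factorial := by positivity
    have := poch_pos hg (n + 1)
    rw [gammaSeq_eq]
    field_simp
  · filter_upwards with n
    simp

/-- Gauss series coefficient at 1. -/
noncomputable def gA (α β γ : ℝ) (n : ℕ) : ℝ :=
  poch α n * poch β n / (poch γ n * (n.factorial : ℝ))

lemma gA_bigO (α β : ℝ) {γ : ℝ} (hg : 0 < γ) :
    (fun n : ℕ => ((n + 1 : ℕ) : ℝ) * gA α β γ (n + 1)) =O[atTop]
      (fun n : ℕ => (n : ℝ) ^ (α + β - γ)) := by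
  have h := (((poch_bigO α).mul (poch_bigO β)).mul (poch_inv_bigO hg)).mul
    (isBigO_refl (fun n : ℕ => ((n.factorial : ℝ))⁻¹) atTop)
  refine (EventuallyEq.isBigO ?_).trans (h.trans (EventuallyEq.isBigO ?_))
  · filter_upwards with n
    have := poch_pos hg (n + 1)
    rw [gA, Nat.factorial_succ]
    push_cast
    field_simp
  · filter_upwards [eventually_gt_atTop 0] with n hn
    have hn' : (0 : ℝ) < n := by exact_mod_cast hn
    rw [rpow_sub hn', rpow_add hn']
    have := rpow_pos_of_pos hn' γ
    field_simp

lemma gA_tendsto (α β : ℝ) {γ : ℝ} (hg : 0 < γ) (h : α + β < γ) :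
    Tendsto (fun n : ℕ => (n : ℝ) * gA α β γ n) atTop (𝓝 0) := by
  rw [← tendsto_add_atTop_iff_nat 1]
  refine (gA_bigO α β hg).trans_tendsto ?_
  have := (tendsto_rpow_neg_atTop (show 0 < γ - (α + β) by linarith)).comp
    (tendsto_natCast_atTop_atTop (R := ℝ))
  refine this.congr fun n => ?_
  simp

lemma gA_summable (α β : ℝ) {γ : ℝ} (hg : 0 < γ) (h : α + β < γ) :
    Summable (fun n : ℕ => |gA α β γ n|) := by
  rw [← summable_nat_add_iff 1]
  apply Summable.abs
  have h2 := (gA_bigO α β hg).mul (isBigO_refl (fun n : ℕ => (((n + 1 : ℕ) : ℝ))⁻¹) atTop)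
  have hs : Summable (fun n : ℕ => (n : ℝ) ^ (α + β - γ - 1)) :=
    Real.summable_nat_rpow.2 (by linarith)
  refine summable_of_isBigO_nat hs ((EventuallyEq.isBigO ?_).trans (h2.trans ?_))
  · filter_upwards with n
    have : ((n + 1 : ℕ) : ℝ) ≠ 0 := by positivity
    field_simp
  · apply IsBigO.of_bound 1
    filter_upwards [eventually_gt_atTop 0] with n hn
    have hn' : (0 : ℝ) < n := by exact_mod_cast hn
    rw [rpow_sub hn' (α + β - γ), rpow_one, one_mul, norm_mul, norm_div, div_eq_mul_inv]
    gcongr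
    rw [norm_inv, norm_of_nonneg (by positivity), norm_of_nonneg (by positivity)]
    gcongr
    simp

lemma gauss_step (α β : ℝ) {γ : ℝ} (hg : 0 < γ) (h : α + β < γ) :
    γ * (γ - α - β) * ∑' n, gA α β γ n
      = (γ - α) * (γ - β) * ∑' n, gA α β (γ + 1) n := by
  have s1 := (gA_summable α β hg h).of_abs
  have s2 := (gA_summable α β (show 0 < γ + 1 by linarith) (by linarith)).of_abs
  have hs := (s1.hasSum.mul_left (γ * (γ - α - β))).sub
    (s2.hasSum.mul_left ((γ - α) * (γ - β)))
  have h0 := hs.tendsto_sum_nat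
  have key : ∀ N : ℕ, ∑ n ∈ Finset.range N, (γ * (γ - α - β) * gA α β γ n
      - (γ - α) * (γ - β) * gA α β (γ + 1) n) = -γ * (N * gA α β γ N) := by
    intro N
    induction N with
    | zero => simp
    | succ n ih =>
      rw [Finset.sum_range_succ, ih]
      have e1 := poch_pos hg n
      have e2 : 0 < γ + n := by positivity
      have e3 : poch (γ + 1) n = poch γ n * (γ + n) / γ := by
        rw [eq_div_iff hg.ne', mul_comm, poch_shift]
      simp only [gA, e3, poch_succ, Nat.factorial_succ]
      push_cast
      field_simp
      ring
  have h1 : Tendsto (fun N : ℕ => -γ * (N * gA α β γ N)) atTop (𝓝 (-γ * 0)) :=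
    (gA_tendsto α β hg h).const_mul _
  simp_rw [key] at h0
  have := tendsto_nhds_unique h0 h1
  linarith

lemma gauss_iter (α β : ℝ) {γ : ℝ} (hg : 0 < γ) (h : α + β < γ) (m : ℕ) :
    poch γ m * poch (γ - α - β) m * ∑' n, gA α β γ n
      = poch (γ - α) m * poch (γ - β) m * ∑' n, gA α β (γ + m) n := by
  induction m with
  | zero => simp [poch_zero]
  | succ m ih =>
    have := gauss_step α β (γ := γ + m) (by positivity) (by have := m.cast_nonneg (α := ℝ); linarith)
    simp only [poch_succ]
    push_cast
    rw [← add_assoc]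
    linear_combination (γ + m) * (γ - α - β + m) * ih + poch (γ - α) m * poch (γ - β) m * this

lemma poch_mono {a b : ℝ} (ha : 0 < a) (hab : a ≤ b) (n : ℕ) : poch a n ≤ poch b n := by
  rw [poch_eq_prod, poch_eq_prod]
  gcongr

lemma gauss_lim (α β : ℝ) {γ : ℝ} (hg : 0 < γ) (h : α + β < γ) :
    Tendsto (fun m : ℕ => ∑' n, gA α β (γ + m) n) atTop (𝓝 1) := by
  have h1 : (1 : ℝ) = ∑' n : ℕ, if n = 0 then (1 : ℝ) else 0 := by simp
  rw [h1]
  refine tendsto_tsum_of_dominated_convergence (gA_summable α β hg h) ?_ ?_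
  · intro n
    rcases n with _ | n
    · simp [gA, poch_zero]
    · simp only [Nat.add_eq_zero_iff, one_ne_zero, and_false, if_false]
      have : Tendsto (fun m : ℕ => poch (γ + m) (n + 1) * ((n + 1).factorial : ℝ)) atTop atTop := by
        apply Tendsto.atTop_mul_const (by positivity)
        apply tendsto_atTop_mono' _ _ (tendsto_natCast_atTop_atTop (R := ℝ) |>.atTop_mul_const
          (poch_pos hg n))
        filter_upwards with m
        rw [poch_succ, mul_comm]
        have := poch_pos hg n
        have := poch_mono hg (show γ ≤ γ + m by simp) n
        have := n.cast_nonneg (α := ℝ)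
        gcongr
        all_goals linarith
      exact this.const_div_atTop _
  · filter_upwards with m n
    rw [gA, gA, norm_eq_abs, abs_div, abs_div]
    have := poch_pos hg n
    have := poch_mono hg (show γ ≤ γ + m by simp) n
    have : 0 < poch (γ + m) n := by linarith
    rw [abs_of_pos (a := poch γ n * _) (by positivity),
      abs_of_pos (a := poch (γ + m) n * _) (by positivity)]
    gcongr

lemma gauss_sum (α β : ℝ) {γ : ℝ} (hg : 0 < γ) (h : α + β < γ) (h1 : α < γ) (h2 : β < γ) :
    ∑' n, gA α β γ n = Gamma γ * Gamma (γ - α - β) / (Gamma (γ - α) * Gamma (γ - β)) := by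
  have p1 : 0 < γ - α := by linarith
  have p2 : 0 < γ - β := by linarith
  have p3 : 0 < γ - α - β := by linarith
  have g1 := (Gamma_pos_of_pos p1).ne'
  have g2 := (Gamma_pos_of_pos p2).ne'
  have t := ((((GammaSeq_tendsto_Gamma γ).mul (GammaSeq_tendsto_Gamma (γ - α - β))).div
    ((GammaSeq_tendsto_Gamma (γ - α)).mul (GammaSeq_tendsto_Gamma (γ - β)))
    (mul_ne_zero g1 g2))).mul ((tendsto_add_atTop_iff_nat 1).2 (gauss_lim α β hg h))
  rw [mul_one] at t
  refine tendsto_nhds_unique (tendsto_const_nhds.congr' ?_) t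
  filter_upwards [eventually_gt_atTop 0] with n hn
  have hn' : (0 : ℝ) < n := by exact_mod_cast hn
  have it := gauss_iter α β hg h (n + 1)
  have q0 := poch_pos hg (n + 1)
  have q1 := poch_pos p1 (n + 1)
  have q2 := poch_pos p2 (n + 1)
  have q3 := poch_pos p3 (n + 1)
  have r : (n : ℝ) ^ γ * (n : ℝ) ^ (γ - α - β) = (n : ℝ) ^ (γ - α) * (n : ℝ) ^ (γ - β) := by
    rw [← rpow_add hn', ← rpow_add hn']; congr 1; ring
  have e : ∑' n, gA α β γ n = poch (γ - α) (n + 1) * poch (γ - β) (n + 1) /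
      (poch γ (n + 1) * poch (γ - α - β) (n + 1)) * ∑' k, gA α β (γ + (n + 1 : ℕ)) k := by
    field_simp
    linear_combination it
  rw [e]
  congr 1
  simp only [Pi.div_apply, gammaSeq_eq]
  have r1 := rpow_pos_of_pos hn' γ
  have r2 := rpow_pos_of_pos hn' (γ - α)
  have r3 := rpow_pos_of_pos hn' (γ - β)
  have r4 := rpow_pos_of_pos hn' (γ - α - β)
  have r5 : (n : ℝ) ^ γ * (n : ℝ) ^ (γ - α - β) / ((n : ℝ) ^ (γ - α) * (n : ℝ) ^ (γ - β)) = 1 := by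
    rw [r]; field_simp
  have f : (0 : ℝ) < n.factorial := by positivity
  generalize (n : ℝ) ^ γ = R1 at *
  generalize (n : ℝ) ^ (γ - α) = R2 at *
  generalize (n : ℝ) ^ (γ - β) = R3 at *
  generalize (n : ℝ) ^ (γ - α - β) = R4 at *
  field_simp
  linear_combination -r

lemma beta_int {p q : ℝ} (hp : 0 < p) (hq : 0 < q) :
    IntegrableOn (fun t : ℝ => t ^ (p - 1) * (1 - t) ^ (q - 1)) (Set.Ioo 0 1) ∧
    ∫ t in Set.Ioo (0 : ℝ) 1, t ^ (p - 1) * (1 - t) ^ (q - 1)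
      = Gamma p * Gamma q / Gamma (p + q) := by
  have h2 : ∫ t in Set.Ioo (0 : ℝ) 1, t ^ (p - 1) * (1 - t) ^ (q - 1)
      = Gamma p * Gamma q / Gamma (p + q) := by
    have := ProbabilityTheory.beta_eq_betaIntegralReal p q hp hq
    rw [ProbabilityTheory.beta] at this
    rw [this, Complex.betaIntegral, intervalIntegral.integral_of_le (by norm_num),
      ← integral_Ioc_eq_integral_Ioo, ← RCLike.re_to_complex, ← integral_re]
    · refine setIntegral_congr_fun measurableSet_Ioc fun x ⟨hx1, hx₂⟩ ↦ ?_
      norm_cast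
      rw [← Complex.ofReal_cpow, ← Complex.ofReal_cpow, RCLike.re_to_complex,
        Complex.re_mul_ofReal, Complex.ofReal_re]
      all_goals linarith
    convert! Complex.betaIntegral_convergent (u := p) (v := q) (by simpa) (by simpa)
    rw [intervalIntegrable_iff_integrableOn_Ioc_of_le (by simp), IntegrableOn]
  refine ⟨?_, h2⟩
  have : 0 < Gamma p * Gamma q / Gamma (p + q) := ProbabilityTheory.beta_pos hp hq
  exact Integrable.of_integral_ne_zero (by rw [h2]; exact this.ne')

lemma Gamma_add_nat' {a : ℝ} (ha : 0 < a) (n : ℕ) : Gamma (a + n) = poch a n * Gamma a := by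
  induction n with
  | zero => simp [poch_zero]
  | succ n ih =>
    push_cast
    rw [← add_assoc, Gamma_add_one (by positivity), ih, poch_succ]
    ring

/-- The weight. -/
noncomputable def wt (b c d e t : ℝ) : ℝ :=
  t ^ (b - 1) * (1 - t) ^ (d + e - b - c - 1) * F21 (e - c) (d - c) (d + e - b - c) (1 - t)

lemma wt_int {b c d e : ℝ} (hb : 0 < b) (hc : 0 < c) (hd : 0 < d) (he : 0 < e)
    (hs : 0 < d + e - b - c) :
    IntegrableOn (wt b c d e) (Set.Ioo 0 1) ∧
    ∫ t in Set.Ioo (0 : ℝ) 1, wt b c d e t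
      = Gamma b * Gamma c * Gamma (d + e - b - c) / (Gamma d * Gamma e) := by
  have G1 := Gamma_pos_of_pos hb
  have G2 := Gamma_pos_of_pos hc
  have G3 := Gamma_pos_of_pos hd
  have G4 := Gamma_pos_of_pos he
  have G5 := Gamma_pos_of_pos hs
  suffices h : ∫ t in Set.Ioo (0 : ℝ) 1, wt b c d e t
      = Gamma b * Gamma c * Gamma (d + e - b - c) / (Gamma d * Gamma e) by
    refine ⟨Integrable.of_integral_ne_zero ?_, h⟩
    rw [h]; positivity
  set s := d + e - b - c with hsdef
  have hbs : 0 < b + s := by linarith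
  have G6 := Gamma_pos_of_pos hbs
  let F : ℕ → ℝ → ℝ := fun n t =>
    gA (e - c) (d - c) s n * (t ^ (b - 1) * (1 - t) ^ (s + n - 1))
  have hbeta := fun n : ℕ => beta_int hb (show 0 < s + n by positivity)
  have hval : ∀ n : ℕ, gA (e - c) (d - c) s n * (Gamma b * Gamma (s + n) / Gamma (b + (s + n)))
      = Gamma b * Gamma s / Gamma (b + s) * gA (e - c) (d - c) (b + s) n := by
    intro n
    have := poch_pos hs n
    have := poch_pos hbs n
    rw [← add_assoc, Gamma_add_nat' hs, Gamma_add_nat' hbs, gA, gA]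
    field_simp
  have hFi : ∀ n, IntegrableOn (F n) (Set.Ioo 0 1) := fun n => (hbeta n).1.const_mul _
  have hFv : ∀ n, ∫ t in Set.Ioo (0 : ℝ) 1, F n t
      = Gamma b * Gamma s / Gamma (b + s) * gA (e - c) (d - c) (b + s) n := by
    intro n
    rw [← hval, ← (hbeta n).2, ← integral_const_mul]
  have hFn : ∀ n, ∫ t in Set.Ioo (0 : ℝ) 1, ‖F n t‖
      = Gamma b * Gamma s / Gamma (b + s) * |gA (e - c) (d - c) (b + s) n| := by
    intro n
    have : 0 < Gamma b * Gamma s / Gamma (b + s) := by positivity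
    rw [← abs_of_pos this, ← abs_mul, ← hval, abs_mul, ← (hbeta n).2,
      abs_of_nonneg (a := ∫ t in Set.Ioo (0 : ℝ) 1, _), ← integral_const_mul]
    · refine setIntegral_congr_fun measurableSet_Ioo fun t ht => ?_
      have h1 := ht.1
      have h2 : 0 < 1 - t := by linarith [ht.2]
      simp only [F, norm_mul, norm_eq_abs]
      rw [abs_of_pos (rpow_pos_of_pos h1 _), abs_of_pos (rpow_pos_of_pos h2 _)]
    · refine setIntegral_nonneg measurableSet_Ioo fun t ht => ?_
      have h1 := ht.1
      have h2 : 0 < 1 - t := by linarith [ht.2]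
      positivity
  have hlt : e - c + (d - c) < b + s := by linarith
  have hsum : Summable fun n => ∫ t in Set.Ioo (0 : ℝ) 1, ‖F n t‖ := by
    simp_rw [hFn]
    exact (gA_summable _ _ hbs hlt).mul_left _
  have H := (hasSum_integral_of_summable_integral_norm hFi hsum).tsum_eq
  simp_rw [hFv] at H
  rw [tsum_mul_left, gauss_sum _ _ hbs hlt (by linarith) (by linarith)] at H
  have e1 : b + s - (e - c) = d := by linarith
  have e2 : b + s - (d - c) = e := by linarith
  have e3 : d - (d - c) = c := by linarith
  rw [e1, e2, e3] at H
  have H2 : ∫ t in Set.Ioo (0 : ℝ) 1, wt b c d e t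
      = ∫ t in Set.Ioo (0 : ℝ) 1, ∑' n, F n t := by
    refine setIntegral_congr_fun measurableSet_Ioo fun t ht => ?_
    have h2 : 0 < 1 - t := by linarith [ht.2]
    simp only [wt, F21, ← hsdef]
    rw [← tsum_mul_left]
    refine tsum_congr fun n => ?_
    simp only [F, gA]
    rw [show s + n - 1 = (s - 1) + n by ring, rpow_add h2, rpow_natCast]
    ring
  rw [H2, ← H]
  field_simp

lemma wt_shift (b c d e p : ℝ) {t : ℝ} (ht : 0 < t) :
    wt (b + p) (c + p) (d + p) (e + p) t = t ^ p * wt b c d e t := by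
  simp only [wt]
  rw [show e + p - (c + p) = e - c by ring, show d + p - (c + p) = d - c by ring,
    show d + p + (e + p) - (b + p) - (c + p) = d + e - b - c by ring,
    show b + p - 1 = p + (b - 1) by ring, rpow_add ht]
  ring

lemma wt_moment {b c d e : ℝ} (p : ℝ) (hb : 0 < b + p) (hc : 0 < c + p) (hd : 0 < d + p)
    (he : 0 < e + p) (hs : 0 < d + e - b - c) :
    IntegrableOn (fun t => t ^ p * wt b c d e t) (Set.Ioo 0 1) ∧
    ∫ t in Set.Ioo (0 : ℝ) 1, t ^ p * wt b c d e t
      = Gamma (b + p) * Gamma (c + p) * Gamma (d + e - b - c) /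
        (Gamma (d + p) * Gamma (e + p)) := by
  have hs' : d + p + (e + p) - (b + p) - (c + p) = d + e - b - c := by ring
  have h := wt_int hb hc hd he (by rw [hs']; exact hs)
  rw [hs'] at h
  constructor
  · exact h.1.congr_fun (fun t ht => wt_shift b c d e p ht.1) measurableSet_Ioo
  · rw [← h.2]
    exact setIntegral_congr_fun measurableSet_Ioo fun t ht => (wt_shift b c d e p ht.1).symm

lemma weier {u v : ℝ → ℝ} (hu : IntegrableOn u (Set.Ioo 0 1)) (hv : IntegrableOn v (Set.Ioo 0 1))
    (hm : ∀ n : ℕ, ∫ t in Set.Ioo (0 : ℝ) 1, t ^ n * u t = ∫ t in Set.Ioo (0 : ℝ) 1, t ^ n * v t)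
    {f : ℝ → ℝ} (hf : ContinuousOn f (Set.Icc 0 1)) :
    ∫ t in Set.Ioo (0 : ℝ) 1, f t * u t = ∫ t in Set.Ioo (0 : ℝ) 1, f t * v t := by
  have cmul : ∀ {g w : ℝ → ℝ}, ContinuousOn g (Set.Icc 0 1) → IntegrableOn w (Set.Ioo 0 1) →
      IntegrableOn (fun t => g t * w t) (Set.Ioo 0 1) := by
    intro g w hg hw
    have hw' : IntegrableOn w (Set.Icc 0 1) := by
      rwa [integrableOn_Icc_iff_integrableOn_Ioo]
    exact (hw'.continuousOn_mul hg isCompact_Icc).mono_set Set.Ioo_subset_Icc_self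
  have huv : IntegrableOn (fun t => u t - v t) (Set.Ioo 0 1) := hu.sub hv
  have hp : ∀ p : Polynomial ℝ, ∫ t in Set.Ioo (0 : ℝ) 1, p.eval t * (u t - v t) = 0 := by
    intro p
    induction p using Polynomial.induction_on' with
    | add p q h1 h2 =>
      simp only [Polynomial.eval_add, add_mul]
      rw [integral_add (cmul p.continuousOn huv) (cmul q.continuousOn huv), h1, h2, add_zero]
    | monomial n a =>
      simp only [Polynomial.eval_monomial, mul_assoc]
      rw [integral_const_mul]
      simp only [mul_sub]
      rw [integral_sub (cmul (by fun_prop) hu) (cmul (by fun_prop) hv), hm n, sub_self, mul_zero]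
  rw [← sub_eq_zero, ← integral_sub (cmul hf hu) (cmul hf hv)]
  simp only [← mul_sub]
  set I := ∫ t in Set.Ioo (0 : ℝ) 1, |u t - v t| with hI
  have hI0 : 0 ≤ I := integral_nonneg fun _ => abs_nonneg _
  rw [← abs_nonpos_iff]
  refine le_of_forall_pos_le_add fun ε hε => ?_
  obtain ⟨p, hpf⟩ := exists_polynomial_near_of_continuousOn 0 1 f hf (ε / (I + 1)) (by positivity)
  rw [zero_add]
  calc |∫ t in Set.Ioo (0 : ℝ) 1, f t * (u t - v t)|
      = |∫ t in Set.Ioo (0 : ℝ) 1, (f t * (u t - v t) - p.eval t * (u t - v t))| := by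
        rw [integral_sub (cmul hf huv) (cmul p.continuousOn huv), hp, sub_zero]
    _ ≤ ∫ t in Set.Ioo (0 : ℝ) 1, |f t * (u t - v t) - p.eval t * (u t - v t)| :=
        abs_integral_le_integral_abs
    _ ≤ ∫ t in Set.Ioo (0 : ℝ) 1, ε / (I + 1) * |u t - v t| := by
        refine setIntegral_mono_on ((cmul hf huv).sub (cmul p.continuousOn huv)).abs
          (huv.abs.const_mul _) measurableSet_Ioo fun t ht => ?_
        rw [← sub_mul, abs_mul]
        gcongr
        rw [abs_sub_comm]
        exact (hpf t (Set.Ioo_subset_Icc_self ht)).le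
    _ = ε / (I + 1) * I := by rw [integral_const_mul]
    _ ≤ ε := by
        rw [div_mul_eq_mul_div, div_le_iff₀ (by positivity)]
        nlinarith

lemma G32_eq (b c d e x : ℝ) (hx : 0 < x) : G32 1 b c d e x =
    Gamma d * Gamma e / (Gamma b * Gamma c * Gamma (d + e - b - c)) *
      ∫ t in Set.Ioo (0 : ℝ) 1, (1 + x * t)⁻¹ * wt b c d e t := by
  rw [G32]
  congr 1
  refine setIntegral_congr_fun measurableSet_Ioo fun t ht => ?_
  have h1 := ht.1
  have : 0 < 1 + x * t := by positivity
  simp only [wt]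
  rw [rpow_neg this.le, rpow_one]
  ring

lemma cont_inv {x : ℝ} (hx : 0 < x) : ContinuousOn (fun t : ℝ => (1 + x * t)⁻¹) (Set.Icc 0 1) := by
  refine ContinuousOn.inv₀ (by fun_prop) fun t ht => ?_
  have := ht.1
  positivity

lemma G32_swap {b c d e x : ℝ} (hb : 0 < b) (hc : 0 < c) (hd : 0 < d) (he : 0 < e)
    (hs : 0 < d + e - b - c) (hx : 0 < x) : G32 1 b c d e x = G32 1 c b d e x := by
  have hs' : 0 < d + e - c - b := by linarith
  have es : d + e - c - b = d + e - b - c := by ring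
  rw [G32_eq _ _ _ _ _ hx, G32_eq _ _ _ _ _ hx,
    weier (wt_int hb hc hd he hs).1 (wt_int hc hb hd he hs').1 ?_ (cont_inv hx), es,
    mul_comm (Gamma b)]
  intro n
  have h1 := (wt_moment (n : ℝ) (by positivity) (by positivity) (by positivity) (by positivity) hs
    (b := b) (c := c) (d := d) (e := e)).2
  have h2 := (wt_moment (n : ℝ) (by positivity) (by positivity) (by positivity) (by positivity) hs'
    (b := c) (c := b) (d := d) (e := e)).2
  simp only [rpow_natCast] at h1 h2
  rw [h1, h2, es, mul_comm (Gamma (c + n))]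

lemma wt_nonneg {b c d e : ℝ} (hcd : c < d) (hce : c < e) (hs : 0 < d + e - b - c)
    {t : ℝ} (ht : t ∈ Set.Ioo (0 : ℝ) 1) : 0 ≤ wt b c d e t := by
  have h1 := ht.1
  have h2 : 0 < 1 - t := by linarith [ht.2]
  rw [wt, F21]
  refine mul_nonneg (by positivity) (tsum_nonneg fun n => ?_)
  have := poch_pos hs n
  have := poch_pos (sub_pos.2 hcd) n
  have := poch_pos (sub_pos.2 hce) n
  positivity

lemma strict_pos {w k : ℝ → ℝ} {m : ℝ} (hw : ∀ t ∈ Set.Ioo (0 : ℝ) 1, 0 ≤ w t)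
    (hk : ∀ t ∈ Set.Ioo (0 : ℝ) 1, t ≠ m → 0 < k t) (hk0 : ∀ t ∈ Set.Ioo (0 : ℝ) 1, 0 ≤ k t)
    (hI : IntegrableOn (fun t => k t * w t) (Set.Ioo 0 1))
    (hpos : ∫ t in Set.Ioo (0 : ℝ) 1, w t ≠ 0) :
    0 < ∫ t in Set.Ioo (0 : ℝ) 1, k t * w t := by
  have hnn : 0 ≤ᵐ[volume.restrict (Set.Ioo (0 : ℝ) 1)] fun t => k t * w t :=
    ae_restrict_of_forall_mem measurableSet_Ioo fun t ht => mul_nonneg (hk0 t ht) (hw t ht)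
  refine lt_of_le_of_ne (integral_nonneg_of_ae hnn) fun h => hpos ?_
  have h0 := (integral_eq_zero_iff_of_nonneg_ae hnn hI).1 h.symm
  have hne : ∀ᵐ t ∂(volume.restrict (Set.Ioo (0 : ℝ) 1)), t ≠ m :=
    ae_restrict_of_ae (Measure.ae_ne volume m)
  have : w =ᵐ[volume.restrict (Set.Ioo (0 : ℝ) 1)] 0 := by
    filter_upwards [h0, hne, ae_restrict_mem measurableSet_Ioo] with t h1 h2 h3
    exact (mul_eq_zero.1 h1).resolve_left (hk t h3 h2).ne'
  rw [integral_congr_ae this]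
  simp

lemma main_good {b c d e x : ℝ} (hb : 1 < b) (hc : 1 < c) (hcd : c < d) (hce : c < e)
    (hs : 0 < d + e - b - c) (hx : 0 < x) :
    1 / (1 + x * (b * c) / (d * e)) < G32 1 b c d e x ∧
      G32 1 b c d e x < 1 / (1 + x * ((b - 1) * (c - 1)) / ((d - 1) * (e - 1))) := by
  have hb0 : 0 < b - 1 := by linarith
  have hc0 : 0 < c - 1 := by linarith
  have hd0 : 0 < d - 1 := by linarith
  have he0 : 0 < e - 1 := by linarith
  have hb1 : 0 < b := by linarith
  have hc1 : 0 < c := by linarith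
  have hd1 : 0 < d := by linarith
  have he1 : 0 < e := by linarith
  have gb : Gamma b = (b - 1) * Gamma (b - 1) := by
    rw [← Gamma_add_one hb0.ne', sub_add_cancel]
  have gc : Gamma c = (c - 1) * Gamma (c - 1) := by
    rw [← Gamma_add_one hc0.ne', sub_add_cancel]
  have gd : Gamma d = (d - 1) * Gamma (d - 1) := by
    rw [← Gamma_add_one hd0.ne', sub_add_cancel]
  have ge : Gamma e = (e - 1) * Gamma (e - 1) := by
    rw [← Gamma_add_one he0.ne', sub_add_cancel]
  have G1 := Gamma_pos_of_pos hb0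
  have G2 := Gamma_pos_of_pos hc0
  have G3 := Gamma_pos_of_pos hd0
  have G4 := Gamma_pos_of_pos he0
  have G1' := Gamma_pos_of_pos hb1
  have G2' := Gamma_pos_of_pos hc1
  have G3' := Gamma_pos_of_pos hd1
  have G4' := Gamma_pos_of_pos he1
  have G5 := Gamma_pos_of_pos hs
  obtain ⟨i0, v0⟩ := wt_int hb1 hc1 hd1 he1 hs
  obtain ⟨i1, v1⟩ := wt_moment (b := b) (c := c) (d := d) (e := e) 1 (by linarith) (by linarith)
    (by linarith) (by linarith) hs
  obtain ⟨i2, v2⟩ := wt_moment (b := b) (c := c) (d := d) (e := e) (-1) (by linarith) (by linarith)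
    (by linarith) (by linarith) hs
  simp only [rpow_one] at i1 v1
  simp only [rpow_neg_one, ← sub_eq_add_neg] at i2 v2
  rw [Gamma_add_one hb1.ne', Gamma_add_one hc1.ne', Gamma_add_one hd1.ne',
    Gamma_add_one he1.ne'] at v1
  have ii : IntegrableOn (fun t => (1 + x * t)⁻¹ * wt b c d e t) (Set.Ioo 0 1) := by
    have hw' : IntegrableOn (wt b c d e) (Set.Icc 0 1) := by
      rwa [integrableOn_Icc_iff_integrableOn_Ioo]
    exact (hw'.continuousOn_mul (cont_inv hx) isCompact_Icc).mono_set Set.Ioo_subset_Icc_self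
  have hwn : ∀ t ∈ Set.Ioo (0 : ℝ) 1, 0 ≤ wt b c d e t := fun t ht => wt_nonneg hcd hce hs ht
  rw [G32_eq _ _ _ _ _ hx]
  set K := Gamma b * Gamma c * Gamma (d + e - b - c) / (Gamma d * Gamma e) with hK
  have hK0 : 0 < K := by positivity
  have hne : ∫ t in Set.Ioo (0 : ℝ) 1, wt b c d e t ≠ 0 := by rw [v0]; exact hK0.ne'
  have hKi : Gamma d * Gamma e / (Gamma b * Gamma c * Gamma (d + e - b - c)) = K⁻¹ := by
    rw [hK, inv_div]
  rw [hKi]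
  set J := ∫ t in Set.Ioo (0 : ℝ) 1, (1 + x * t)⁻¹ * wt b c d e t with hJ
  set w := wt b c d e with hw
  obtain ⟨m, hm⟩ : ∃ m, m = b * c / (d * e) := ⟨_, rfl⟩
  obtain ⟨q, hq⟩ : ∃ q, q = (b - 1) * (c - 1) / ((d - 1) * (e - 1)) := ⟨_, rfl⟩
  have hm0 : 0 < m := by rw [hm]; positivity
  have hq0 : 0 < q := by rw [hq]; positivity
  have v1' : ∫ t in Set.Ioo (0 : ℝ) 1, t * w t = m * K := by
    rw [v1, hm, hK]; field_simp
  have v2' : ∫ t in Set.Ioo (0 : ℝ) 1, t⁻¹ * w t = q⁻¹ * K := by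
    rw [v2, hq, hK, gb, gc, gd, ge]; field_simp
  rw [mul_div_assoc x (b * c), mul_div_assoc x ((b - 1) * (c - 1)), ← hm, ← hq]
  constructor
  · have hcombo : ∀ t ∈ Set.Ioo (0 : ℝ) 1,
        (x ^ 2 * (t - m) ^ 2 / ((1 + x * m) ^ 2 * (1 + x * t))) * w t
        = (1 + x * t)⁻¹ * w t - ((1 + 2 * x * m) / (1 + x * m) ^ 2 * w t
            - x / (1 + x * m) ^ 2 * (t * w t)) := by
      intro t ht
      have h1 := ht.1
      field_simp
      ring
    have hc1 : IntegrableOn (fun t => (1 + 2 * x * m) / (1 + x * m) ^ 2 * w t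
            - x / (1 + x * m) ^ 2 * (t * w t)) (Set.Ioo 0 1) :=
      (i0.const_mul _).sub (i1.const_mul _)
    have hint : IntegrableOn (fun t => (1 + x * t)⁻¹ * w t - ((1 + 2 * x * m) / (1 + x * m) ^ 2 * w t
            - x / (1 + x * m) ^ 2 * (t * w t))) (Set.Ioo 0 1) :=
      ii.sub ((i0.const_mul _).sub (i1.const_mul _))
    have hp := strict_pos (m := m) hwn
      (k := fun t => x ^ 2 * (t - m) ^ 2 / ((1 + x * m) ^ 2 * (1 + x * t)))
      (fun t ht hne => by
        have h1 := ht.1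
        have : t - m ≠ 0 := sub_ne_zero.2 hne
        positivity)
      (fun t ht => by have h1 := ht.1; positivity)
      (hint.congr_fun (fun t ht => (hcombo t ht).symm) measurableSet_Ioo) hne
    rw [setIntegral_congr_fun measurableSet_Ioo hcombo, integral_sub ii hc1, integral_sub (i0.const_mul _) (i1.const_mul _),
      integral_const_mul, integral_const_mul, v0, v1', ← hJ] at hp
    rw [inv_mul_eq_div, lt_div_iff₀ hK0]
    have : 1 / (1 + x * m) * K = (1 + 2 * x * m) / (1 + x * m) ^ 2 * K
        - x / (1 + x * m) ^ 2 * (m * K) := by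
      field_simp
      ring
    linarith
  · have hcombo : ∀ t ∈ Set.Ioo (0 : ℝ) 1,
        (x * (t - q) ^ 2 / ((1 + x * q) ^ 2 * (1 + x * t) * t)) * w t
        = (1 / (1 + x * q) ^ 2 * w t + x * q ^ 2 / (1 + x * q) ^ 2 * (t⁻¹ * w t))
          - (1 + x * t)⁻¹ * w t := by
      intro t ht
      have h1 := ht.1
      field_simp
      ring
    have hc1 : IntegrableOn (fun t => 1 / (1 + x * q) ^ 2 * w t
        + x * q ^ 2 / (1 + x * q) ^ 2 * (t⁻¹ * w t)) (Set.Ioo 0 1) :=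
      (i0.const_mul _).add (i2.const_mul _)
    have hint : IntegrableOn (fun t => (1 / (1 + x * q) ^ 2 * w t
        + x * q ^ 2 / (1 + x * q) ^ 2 * (t⁻¹ * w t)) - (1 + x * t)⁻¹ * w t) (Set.Ioo 0 1) :=
      ((i0.const_mul _).add (i2.const_mul _)).sub ii
    have hp := strict_pos (m := q) hwn
      (k := fun t => x * (t - q) ^ 2 / ((1 + x * q) ^ 2 * (1 + x * t) * t))
      (fun t ht hne => by
        have h1 := ht.1
        have : t - q ≠ 0 := sub_ne_zero.2 hne
        positivity)
      (fun t ht => by have h1 := ht.1; positivity)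
      (hint.congr_fun (fun t ht => (hcombo t ht).symm) measurableSet_Ioo) hne
    rw [setIntegral_congr_fun measurableSet_Ioo hcombo, integral_sub hc1 ii, integral_add (i0.const_mul _) (i2.const_mul _),
      integral_const_mul, integral_const_mul, v0, v2', ← hJ] at hp
    rw [inv_mul_eq_div, div_lt_iff₀ hK0]
    have : 1 / (1 + x * q) * K = 1 / (1 + x * q) ^ 2 * K
        + x * q ^ 2 / (1 + x * q) ^ 2 * (q⁻¹ * K) := by
      field_simp
    linarith

/-- Two-sided bounds for `₃F₂(1, b, c; d, e; −x)` for `x > 0`. -/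
theorem G32_two_sided (b c d e x : ℝ) (hb : 1 < b) (hc : 1 < c)
    (hde : 0 < d + e - b - c) (hmin : min b c < min d e) (hx : 0 < x) :
    1 / (1 + x * (b * c) / (d * e)) < G32 1 b c d e x ∧
      G32 1 b c d e x < 1 / (1 + x * ((b - 1) * (c - 1)) / ((d - 1) * (e - 1))) := by
  obtain ⟨h1, h2⟩ := lt_min_iff.1 hmin
  rcases le_total c b with h | h
  · rw [min_eq_right h] at h1 h2
    exact main_good hb hc h1 h2 hde hx
  · rw [min_eq_left h] at h1 h2
    rw [G32_swap (by linarith) (by linarith) (by linarith) (by linarith) hde hx,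
      mul_comm b c, mul_comm (b - 1)]
    exact main_good hc hb h1 h2 (by linarith) hx
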